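/- arXiv:2209.11988 — 2 statements merged into one kernel-verified Lean document; each statement's English description precedes it below -/
import Mathlib

section
/- Let C₁, …, Cₙ (n ≥ 2) be pairwise disjoint compact convex sets in the plane. Then there exist indices i ≠ j such that every line separating Cᵢ from Cⱼ has the property that one of its two open halfplanes contains at least n/18 of the sets C₁, …, Cₙ entirely, while the set among Cᵢ, Cⱼ on the other side is separated from all of them. -/
/-- Two disjoint convex sets meeting the horizontal axis at `a` and `b` cannot swap sides: the
segment from `(a, 0)` to `p`, cut at the height of `q`, lies on the same side of `q` as `a` does
of `b`. -/
theorem segment_same_side {A B : Set (ℝ × ℝ)} (hA : Convex ℝ A) (hB : Convex ℝ B)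
    (hAB : Disjoint A B) {a b l : ℝ} (ha : (a, 0) ∈ A) (hb : (b, 0) ∈ B) {p q : ℝ × ℝ}
    (hp : p ∈ A) (hq : q ∈ B) (hl0 : 0 ≤ l) (hl1 : l ≤ 1) (hpq : q.2 = l * p.2) :
    0 < (a - b) * ((a + l * (p.1 - a)) - q.1) := by
  by_contra! h
  obtain ⟨t, ht0, ht1, ht⟩ : ∃ t : ℝ, 0 ≤ t ∧ t ≤ 1 ∧
      (1 - t) * (a - b) + t * ((a + l * (p.1 - a)) - q.1) = 0 := by
    generalize a + l * (p.1 - a) - q.1 = y at h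
    generalize a - b = x at h
    rcases lt_trichotomy x 0 with hx | hx | hx
    · have hy : 0 ≤ y := by nlinarith
      refine ⟨-x / (y - x), by apply div_nonneg <;> linarith,
        (div_le_one (by linarith)).2 (by linarith), ?_⟩
      have : y - x ≠ 0 := by linarith
      field_simp
      ring
    · exact ⟨0, le_rfl, zero_le_one, by simp [hx]⟩
    · have hy : y ≤ 0 := by nlinarith
      refine ⟨x / (x - y), by apply div_nonneg <;> linarith,
        (div_le_one (by linarith)).2 (by linarith), ?_⟩
      have : x - y ≠ 0 := by linarith
      field_simp
      ring
  have htl : t * l ≤ 1 := mul_le_one₀ ht1 hl0 hl1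
  have h1 := hA ha hp (sub_nonneg.2 htl) (mul_nonneg ht0 hl0) (by ring)
  have h2 := hB hb hq (sub_nonneg.2 ht1) ht0 (by ring)
  refine Set.disjoint_left.1 hAB h1 ?_
  convert h2 using 1
  ext
  · simp only [Prod.fst_add, Prod.smul_fst, smul_eq_mul]
    linarith
  · simp only [Prod.snd_add, Prod.smul_snd, smul_eq_mul, hpq]
    ring

theorem exists_ratio {ε δ h k : ℝ} (hε : 0 ≤ ε * δ) (hk : 0 < δ * k) (hkh : ε * k ≤ ε * h)
    (hε0 : ε ≠ 0) : ∃ l, 0 < l ∧ l ≤ 1 ∧ k = l * h := by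
  have hk' : 0 < ε * k := by
    have hδ : δ ≠ 0 := by rintro rfl; simp at hk
    have : k ≠ 0 := by rintro rfl; simp at hk
    refine lt_of_le_of_ne ?_ (Ne.symm (mul_ne_zero hε0 this))
    have h1 : 0 ≤ (ε * δ) * (δ * k) := mul_nonneg hε hk.le
    have h2 : 0 < δ ^ 2 := by positivity
    nlinarith
  have hh : 0 < ε * h := hk'.trans_le hkh
  refine ⟨(ε * k) / (ε * h), div_pos hk' hh, (div_le_one hh).2 hkh, ?_⟩
  have : h ≠ 0 := by rintro rfl; simp at hh
  field_simp

/-- Suppose `A` and `B` lie to the right of two lines respectively, the second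
of which meets the axis further right. If `A` reaches at least as
high as `B` on the side where the lines converge, then `B` is to the right of the first line. -/
theorem right_of_line {A B : Set (ℝ × ℝ)} (hA : Convex ℝ A) (hB : Convex ℝ B)
    (hAB : Disjoint A B) {a b e e' β β' ε : ℝ} (ha : (a, 0) ∈ A) (hb : (b, 0) ∈ B) (hab : a < b)
    (hAe : ∀ p ∈ A, e < p.1 + β * p.2) (hBe : ∀ p ∈ B, e' < p.1 + β' * p.2) (hee : e ≤ e')
    (hε0 : ε ≠ 0) (hε : 0 ≤ ε * (β' - β)) {p : ℝ × ℝ} (hp : p ∈ A)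
    (hpB : ∀ q ∈ B, ε * q.2 ≤ ε * p.2) : ∀ q ∈ B, e < q.1 + β * q.2 := by
  intro q hq
  by_contra! h
  have h1 := hBe q hq
  obtain ⟨l, hl0, hl1, hl⟩ := exists_ratio hε (by nlinarith) (hpB q hq) hε0
  have h2 := segment_same_side hA hB hAB ha hb hp hq hl0.le hl1 hl
  have h3 := hAe p hp
  have h4 := hAe _ ha
  have h5 : a + l * (p.1 - a) < q.1 := by nlinarith
  simp only [mul_zero, add_zero] at h4
  have h6 := mul_pos hl0 (sub_pos.2 h3)
  have h7 := mul_nonneg (sub_nonneg.2 hl1) (sub_pos.2 h4).le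
  rw [hl] at h
  linarith

/-- The mirror image of `right_of_line`. -/
theorem left_of_line {A B : Set (ℝ × ℝ)} (hA : Convex ℝ A) (hB : Convex ℝ B)
    (hAB : Disjoint A B) {a b e e' β β' ε : ℝ} (ha : (a, 0) ∈ A) (hb : (b, 0) ∈ B) (hab : b < a)
    (hAe : ∀ p ∈ A, p.1 + β' * p.2 < e') (hBe : ∀ p ∈ B, p.1 + β * p.2 < e) (hee : e ≤ e')
    (hε0 : ε ≠ 0) (hε : 0 ≤ ε * (β' - β)) {p : ℝ × ℝ} (hp : p ∈ A)
    (hpB : ∀ q ∈ B, ε * q.2 ≤ ε * p.2) : ∀ q ∈ B, q.1 + β' * q.2 < e' := by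
  intro q hq
  by_contra! h
  have h1 := hBe q hq
  obtain ⟨l, hl0, hl1, hl⟩ := exists_ratio hε (by nlinarith) (hpB q hq) hε0
  have h2 := segment_same_side hA hB hAB ha hb hp hq hl0.le hl1 hl
  have h3 := hAe p hp
  have h4 := hAe _ ha
  have h5 : q.1 < a + l * (p.1 - a) := by nlinarith
  simp only [mul_zero, add_zero] at h4
  have h6 := mul_pos hl0 (sub_pos.2 h3)
  have h7 := mul_nonneg (sub_nonneg.2 hl1) (sub_pos.2 h4).le
  rw [hl] at h
  linarith

open Finset in
theorem exists_order_statistic {ι : Type*} (s : Finset ι) (f : ι → ℝ) {M : ℕ} (hs : M < #s) :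
    ∃ α, M < #{x ∈ s | f x ≤ α} ∧ #{x ∈ s | f x < α} ≤ M := by
  classical
  have hne : ({x ∈ s | M < #{y ∈ s | f y ≤ f x}} : Finset ι).Nonempty := by
    obtain ⟨x, hx, hmax⟩ := s.exists_max_image f (card_pos.1 (by omega))
    refine ⟨x, mem_filter.2 ⟨hx, ?_⟩⟩
    rwa [filter_true_of_mem hmax]
  obtain ⟨x, hx, hmin⟩ := exists_min_image _ f hne
  rw [mem_filter] at hx
  refine ⟨f x, hx.2, ?_⟩
  by_contra! h
  obtain ⟨y, hy, hmax⟩ := exists_max_image {y ∈ s | f y < f x} f (card_pos.1 (by omega))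
  rw [mem_filter] at hy
  refine absurd (hmin y (mem_filter.2 ⟨hy.1, h.trans_le (card_le_card fun z hz => ?_)⟩))
    (not_le.2 hy.2)
  exact mem_filter.2 ⟨(mem_filter.1 hz).1, hmax z hz⟩

open Finset in
/-- `h` says that no index `c` has more than `M` lower indices of smaller `u` together with more
than `M` higher indices of smaller `w`; the other assumption exchanges `u` and `w`. -/
theorem card_le_of_many_below {N M : ℕ} {u w : Fin N → ℝ}
    (h : ∀ c, #{b | b < c ∧ u b ≤ u c} ≤ M ∨ #{d | c < d ∧ w d ≤ w c} ≤ M)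
    (h' : ∀ c, #{b | b < c ∧ w b ≤ w c} ≤ M ∨ #{d | c < d ∧ u d ≤ u c} ≤ M) {W : Finset (Fin N)}
    (hW : ∀ c ∈ W, M < #{b | b < c ∧ w b ≤ w c} ∧ M < #{d | c < d ∧ w d ≤ w c}) :
    #W ≤ 2 * M + 1 := by
  rcases W.eq_empty_or_nonempty with rfl | hne
  · simp
  obtain ⟨c, hc, hmax⟩ := exists_max_image W u hne
  have h1 := (h c).resolve_right (not_le.2 (hW c hc).2)
  have h2 := (h' c).resolve_left (not_le.2 (hW c hc).1)
  have h3 : W.erase c ⊆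
      ({b | b < c ∧ u b ≤ u c} : Finset (Fin N)) ∪ ({d | c < d ∧ u d ≤ u c} : Finset (Fin N)) := by
    intro x hx
    rw [mem_erase] at hx
    have := hmax x hx.2
    rcases lt_or_gt_of_ne hx.1 with hlt | hlt <;> simp [hlt, this]
  have h4 := (card_le_card h3).trans (card_union_le _ _)
  rw [card_erase_of_mem hc] at h4
  omega

open Finset in
theorem card_dominated_le {N M : ℕ} {u w : Fin N → ℝ} {X Z : Finset (Fin N)}
    {r : Fin N → Fin N → Prop} [DecidableRel r] (hr : ∀ b ∈ X, ∀ c ∈ Z, r b c)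
    (h : ∀ b ∈ X, #{c | r b c ∧ u c ≤ u b ∧ w c ≤ w b} ≤ M) {α β : ℝ}
    (hX : 2 * M < #X) (hα : #{x ∈ X | u x < α} ≤ M) (hβ : #{x ∈ X | w x < β} ≤ M) :
    #{c ∈ Z | u c < α ∧ w c < β} ≤ M := by
  obtain ⟨b, hb, hub, hwb⟩ : ∃ b ∈ X, α ≤ u b ∧ β ≤ w b := by
    by_contra! hcon
    have : X ⊆ {x ∈ X | u x < α} ∪ {x ∈ X | w x < β} := by
      intro x hx
      rcases lt_or_ge (u x) α with hu | hu
      · simp [hx, hu]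
      · simp [hx, hcon x hx hu]
    have := (card_le_card this).trans (card_union_le _ _)
    omega
  refine (card_le_card fun c hc => ?_).trans (h b hb)
  rw [mem_filter] at hc
  exact mem_filter.2 ⟨mem_univ _, hr b hb c hc.1, hc.2.1.le.trans hub, hc.2.2.le.trans hwb⟩

open Finset in
theorem order_heights_contradiction {N M : ℕ} (hN : 10 * M + 7 ≤ N) {u w : Fin N → ℝ}
    (h1 : ∀ c, #{b | b < c ∧ u b ≤ u c} ≤ M ∨ #{d | c < d ∧ w d ≤ w c} ≤ M)
    (h2 : ∀ c, #{b | b < c ∧ w b ≤ w c} ≤ M ∨ #{d | c < d ∧ u d ≤ u c} ≤ M)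
    (h3 : ∀ a b : Fin N, a < b → #{c | b < c ∧ u c ≤ u b ∧ w c ≤ w b} ≤ M)
    (h4 : ∀ a b : Fin N, b < a → #{c | c < b ∧ u c ≤ u b ∧ w c ≤ w b} ≤ M) : False := by
  classical
  have hcard : ∀ a b (hb : b < N), a ≤ b →
      #{i : Fin N | a ≤ i.val ∧ i.val ≤ b} = b + 1 - a := by
    intro a b hb hab
    have : ({i : Fin N | a ≤ i.val ∧ i.val ≤ b} : Finset (Fin N))
        = Finset.Icc (⟨a, by omega⟩ : Fin N) ⟨b, hb⟩ := by
      ext i; simp [Fin.le_def]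
    rw [this, Fin.card_Icc]
  obtain ⟨X, hX⟩ : ∃ X : Finset (Fin N),
      X = ({i : Fin N | 1 ≤ i.val ∧ i.val ≤ 2 * M + 1} : Finset (Fin N)) := ⟨_, rfl⟩
  obtain ⟨Z, hZ⟩ : ∃ Z : Finset (Fin N),
      Z = ({i : Fin N | 2 * M + 2 ≤ i.val ∧ i.val ≤ N - 2 * M - 3} : Finset (Fin N)) := ⟨_, rfl⟩
  obtain ⟨Y, hY⟩ : ∃ Y : Finset (Fin N),
      Y = ({i : Fin N | N - 2 * M - 2 ≤ i.val ∧ i.val ≤ N - 2} : Finset (Fin N)) := ⟨_, rfl⟩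
  have hXc : #X = 2 * M + 1 := by rw [hX, hcard] <;> omega
  have hZc : 6 * M + 3 ≤ #Z := by rw [hZ, hcard] <;> omega
  have hYc : #Y = 2 * M + 1 := by rw [hY, hcard] <;> omega
  have hXZ : ∀ b ∈ X, ∀ c ∈ Z, b < c := by
    intro b hb c hc
    simp only [hX, hZ, mem_filter, mem_univ, true_and] at hb hc
    rw [Fin.lt_def]; omega
  have hZY : ∀ b ∈ Y, ∀ c ∈ Z, c < b := by
    intro b hb c hc
    simp only [hY, hZ, mem_filter, mem_univ, true_and] at hb hc
    rw [Fin.lt_def]; omega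
  obtain ⟨α, hα, hα'⟩ := exists_order_statistic X u (M := M) (by omega)
  obtain ⟨β, hβ, hβ'⟩ := exists_order_statistic X w (M := M) (by omega)
  obtain ⟨γ, hγ, hγ'⟩ := exists_order_statistic Y u (M := M) (by omega)
  obtain ⟨δ, hδ, hδ'⟩ := exists_order_statistic Y w (M := M) (by omega)
  have hl : #{c ∈ Z | u c < α ∧ w c < β} ≤ M := by
    refine card_dominated_le (r := fun b c => b < c) hXZ (fun b hb => ?_) (by omega) hα' hβ'
    refine h3 ⟨0, by omega⟩ b ?_
    simp only [hX, mem_filter, mem_univ, true_and] at hb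
    rw [Fin.lt_def]; exact hb.1
  have hr : #{c ∈ Z | u c < γ ∧ w c < δ} ≤ M := by
    refine card_dominated_le (r := fun b c => c < b) hZY (fun b hb => ?_) (by omega) hγ' hδ'
    refine h4 ⟨N - 1, by omega⟩ b ?_
    simp only [hY, mem_filter, mem_univ, true_and] at hb
    rw [Fin.lt_def]; simp only; omega
  have left : ∀ (f : Fin N → ℝ) (τ : ℝ), M < #{x ∈ X | f x ≤ τ} → ∀ c ∈ Z, τ ≤ f c →
      M < #{b | b < c ∧ f b ≤ f c} := by
    intro f τ hτ c hc hfc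
    refine hτ.trans_le (card_le_card fun x hx => ?_)
    rw [mem_filter] at hx
    exact mem_filter.2 ⟨mem_univ _, hXZ x hx.1 c hc, hx.2.trans hfc⟩
  have right : ∀ (f : Fin N → ℝ) (τ : ℝ), M < #{x ∈ Y | f x ≤ τ} → ∀ c ∈ Z, τ ≤ f c →
      M < #{d | c < d ∧ f d ≤ f c} := by
    intro f τ hτ c hc hfc
    refine hτ.trans_le (card_le_card fun x hx => ?_)
    rw [mem_filter] at hx
    exact mem_filter.2 ⟨mem_univ _, hZY x hx.1 c hc, hx.2.trans hfc⟩
  have hWu : #{c ∈ Z | β ≤ w c ∧ δ ≤ w c} ≤ 2 * M + 1 := by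
    refine card_le_of_many_below h1 h2 fun c hc => ?_
    rw [mem_filter] at hc
    exact ⟨left w β hβ c hc.1 hc.2.1, right w δ hδ c hc.1 hc.2.2⟩
  have hWw : #{c ∈ Z | α ≤ u c ∧ γ ≤ u c} ≤ 2 * M + 1 := by
    refine card_le_of_many_below h2 h1 fun c hc => ?_
    rw [mem_filter] at hc
    exact ⟨left u α hα c hc.1 hc.2.1, right u γ hγ c hc.1 hc.2.2⟩
  have hcover : Z ⊆ (({c ∈ Z | u c < α ∧ w c < β} : Finset (Fin N)) ∪
      {c ∈ Z | u c < γ ∧ w c < δ}) ∪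
      (({c ∈ Z | β ≤ w c ∧ δ ≤ w c} : Finset (Fin N)) ∪ {c ∈ Z | α ≤ u c ∧ γ ≤ u c}) := by
    intro c hc
    have e1 : ¬ (α ≤ u c ∧ δ ≤ w c) := fun ⟨p, q⟩ => by
      rcases h1 c with h | h
      · exact absurd (left u α hα c hc p) (not_lt.2 h)
      · exact absurd (right w δ hδ c hc q) (not_lt.2 h)
    have e2 : ¬ (β ≤ w c ∧ γ ≤ u c) := fun ⟨p, q⟩ => by
      rcases h2 c with h | h
      · exact absurd (left w β hβ c hc p) (not_lt.2 h)
      · exact absurd (right u γ hγ c hc q) (not_lt.2 h)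
    simp only [mem_union, mem_filter, hc, true_and, ← not_le]
    tauto
  have := (card_le_card hcover).trans ((card_union_le _ _).trans
    (add_le_add (card_union_le _ _) (card_union_le _ _)))
  omega

open Finset in
/-- `β i j` is the slope of a line separating `i` from `j`; `R i j d` and `L i j d` say that the set
of index `d` lies to the right, respectively to the left, of that line. -/
theorem card_le_or_card_le {N M : ℕ} {u w : Fin N → ℝ} {β : Fin N → Fin N → ℝ}
    {R L : Fin N → Fin N → Fin N → Prop} [∀ i j, DecidablePred (R i j)]
    [∀ i j, DecidablePred (L i j)]
    (hR : ∀ i j, i < j → #{d | R i j d} ≤ M) (hL : ∀ i j, i < j → #{d | L i j d} ≤ M)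
    (hu : ∀ b c d, b < c → c < d → β b c ≤ β c d → u b ≤ u c → L c d b)
    (hw : ∀ b c d, b < c → c < d → β c d ≤ β b c → w d ≤ w c → R b c d) (c : Fin N) :
    #{b | b < c ∧ u b ≤ u c} ≤ M ∨ #{d | c < d ∧ w d ≤ w c} ≤ M := by
  by_contra! h
  obtain ⟨b, hb, hbmax⟩ := exists_max_image _ (fun b => β b c) (card_pos.1 (pos_of_gt h.1))
  obtain ⟨d, hd, hdmax⟩ := exists_max_image _ (fun d => β c d) (card_pos.1 (pos_of_gt h.2))
  simp only [mem_filter, mem_univ, true_and] at hb hd hbmax hdmax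
  rcases le_total (β b c) (β c d) with hβ | hβ
  · refine absurd (h.1.trans_le (card_le_card fun x hx => ?_)) (not_lt.2 (hL c d hd.1))
    simp only [mem_filter, mem_univ, true_and] at hx ⊢
    exact hu x c d hx.1 hd.1 ((hbmax x hx).trans hβ) hx.2
  · refine absurd (h.2.trans_le (card_le_card fun x hx => ?_)) (not_lt.2 (hR b c hb.1))
    simp only [mem_filter, mem_univ, true_and] at hx ⊢
    exact hw b c x hb.1 hx.1 ((hdmax x hx).trans hβ) hx.2

/-- Sets crossing the horizontal axis from left to right cannot be pairwise separated by lines each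
of which has at most `M` of the sets on either side. -/
theorem exists_heavy_separator {N M : ℕ} (hN : 10 * M + 7 ≤ N) {S : Fin N → Set (ℝ × ℝ)}
    {s : Fin N → ℝ} (hs : StrictMono s) (hmem : ∀ i, (s i, 0) ∈ S i) (hconv : ∀ i, Convex ℝ (S i))
    (hcpt : ∀ i, IsCompact (S i)) (hdis : ∀ i j, i ≠ j → Disjoint (S i) (S j))
    (hsep : ∀ i j, i < j → ∃ e β : ℝ,
      (∀ p ∈ S i, p.1 + β * p.2 < e) ∧ (∀ p ∈ S j, e < p.1 + β * p.2) ∧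
      {k | ∀ p ∈ S k, p.1 + β * p.2 < e}.ncard ≤ M ∧
      {k | ∀ p ∈ S k, e < p.1 + β * p.2}.ncard ≤ M) : False := by
  classical
  choose! e β hl hr hL hR using hsep
  simp only [Set.ncard_eq_toFinset_card', Set.toFinset_ofPred] at hL hR
  have hee : ∀ b c d, b < c → c < d → e b c ≤ e c d := by
    intro b c d hbc hcd
    have h1 := hr b c hbc _ (hmem c)
    have h2 := hl c d hcd _ (hmem c)
    simp only [mul_zero, add_zero] at h1 h2
    linarith
  have hLε : ∀ (ε : ℝ), ε ≠ 0 → ∀ P : Fin N → ℝ × ℝ, (∀ i, P i ∈ S i) →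
      (∀ i, ∀ q ∈ S i, ε * q.2 ≤ ε * (P i).2) → ∀ b c d, b < c → c < d →
      0 ≤ ε * (β c d - β b c) → ε * (P b).2 ≤ ε * (P c).2 →
      ∀ q ∈ S b, q.1 + β c d * q.2 < e c d := by
    intro ε hε P hP hmax b c d hbc hcd hβ hbP
    exact left_of_line (hconv c) (hconv b) (hdis c b hbc.ne') (hmem c) (hmem b) (hs hbc)
      (hl c d hcd) (hl b c hbc) (hee b c d hbc hcd) hε hβ (hP c)
      fun q hq => (hmax b q hq).trans hbP
  have hRε : ∀ (ε : ℝ), ε ≠ 0 → ∀ P : Fin N → ℝ × ℝ, (∀ i, P i ∈ S i) →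
      (∀ i, ∀ q ∈ S i, ε * q.2 ≤ ε * (P i).2) → ∀ b c d, b < c → c < d →
      0 ≤ ε * (β c d - β b c) → ε * (P d).2 ≤ ε * (P c).2 →
      ∀ q ∈ S d, e b c < q.1 + β b c * q.2 := by
    intro ε hε P hP hmax b c d hbc hcd hβ hdP
    exact right_of_line (hconv c) (hconv d) (hdis c d hcd.ne) (hmem c) (hmem d) (hs hcd)
      (hr b c hbc) (hr c d hcd) (hee b c d hbc hcd) hε hβ (hP c)
      fun q hq => (hmax d q hq).trans hdP
  choose t ht htmax using fun i =>
    (hcpt i).exists_isMaxOn ⟨_, hmem i⟩ continuous_snd.continuousOn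
  choose r hr hrmin using fun i =>
    (hcpt i).exists_isMinOn ⟨_, hmem i⟩ continuous_snd.continuousOn
  have htm : ∀ i, ∀ q ∈ S i, (1 : ℝ) * q.2 ≤ 1 * (t i).2 := fun i q hq => by
    simpa using htmax i hq
  have hrm : ∀ i, ∀ q ∈ S i, (-1 : ℝ) * q.2 ≤ -1 * (r i).2 := fun i q hq => by
    simpa using hrmin i hq
  have hLu := hLε 1 one_ne_zero t ht htm
  have hRu := hRε 1 one_ne_zero t ht htm
  have hLw := hLε (-1) (by norm_num) r hr hrm
  have hRw := hRε (-1) (by norm_num) r hr hrm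
  refine order_heights_contradiction hN (u := fun i => 1 * (t i).2) (w := fun i => -1 * (r i).2)
    (card_le_or_card_le (β := β) hR hL ?_ ?_)
    (card_le_or_card_le (β := fun i j => - β i j) hR hL ?_ ?_) ?_ ?_
  · exact fun b c d hbc hcd hβ => hLu b c d hbc hcd (by linarith)
  · exact fun b c d hbc hcd hβ => hRw b c d hbc hcd (by linarith)
  · exact fun b c d hbc hcd hβ => hLw b c d hbc hcd (by linarith)
  · exact fun b c d hbc hcd hβ => hRu b c d hbc hcd (by linarith)
  · refine fun a b hab => (Finset.card_le_card fun c hc => ?_).trans (hR a b hab)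
    simp only [Finset.mem_filter, Finset.mem_univ, true_and] at hc ⊢
    rcases le_total (β a b) (β b c) with h | h
    · exact hRu a b c hab hc.1 (by linarith) hc.2.1
    · exact hRw a b c hab hc.1 (by linarith) hc.2.2
  · refine fun a b hba => (Finset.card_le_card fun c hc => ?_).trans (hL b a hba)
    simp only [Finset.mem_filter, Finset.mem_univ, true_and] at hc ⊢
    rcases le_total (β c b) (β b a) with h | h
    · exact hLu c b a hc.1 hba (by linarith) hc.2.1
    · exact hLw c b a hc.1 hba (by linarith) hc.2.2

open Finset in
theorem exists_strictMono_enumeration {ι : Type*} (T : Finset ι) (g : ι → ℝ)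
    (hg : Set.InjOn g T) : ∃ e : Fin #T → ι, (∀ i, e i ∈ T) ∧ StrictMono (g ∘ e) := by
  have hc : #(T.image g) = #T := card_image_of_injOn hg
  have h : ∀ i, ∃ k ∈ T, g k = (T.image g).orderEmbOfFin hc i := fun i =>
    mem_image.1 (orderEmbOfFin_mem _ hc i)
  choose e he hge using h
  refine ⟨e, he, fun i j hij => ?_⟩
  simp only [Function.comp_apply, hge]
  exact ((T.image g).orderEmbOfFin hc).strictMono hij

theorem linearMap_prod_apply (f : ℝ × ℝ →ₗ[ℝ] ℝ) (p : ℝ × ℝ) :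
    f p = f (1, 0) * p.1 + f (0, 1) * p.2 := by
  have : p = p.1 • ((1, 0) : ℝ × ℝ) + p.2 • ((0, 1) : ℝ × ℝ) := by ext <;> simp
  conv_lhs => rw [this]
  simp only [map_add, map_smul, smul_eq_mul]
  ring

theorem Convex.all_lt_or_all_gt {C : Set (ℝ × ℝ)} (hC : Convex ℝ C) (f : ℝ × ℝ →ₗ[ℝ] ℝ) {c : ℝ}
    (h : ∀ p ∈ C, f p ≠ c) : (∀ p ∈ C, f p < c) ∨ ∀ p ∈ C, c < f p := by
  by_contra! hcon
  obtain ⟨⟨p, hp, hpc⟩, q, hq, hqc⟩ := hcon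
  obtain ⟨x, hx, hxc⟩ := (hC.linear_image f).ordConnected.out ⟨q, hq, rfl⟩ ⟨p, hp, rfl⟩ ⟨hqc, hpc⟩
  exact h x hx hxc

/-- The affine change of coordinates turning the line `f = c` into the horizontal axis. -/
def lineCoordinates (f : ℝ × ℝ →ₗ[ℝ] ℝ) (c : ℝ) (p : ℝ × ℝ) : ℝ × ℝ :=
  (f (1, 0) * p.2 - f (0, 1) * p.1, f p - c)

theorem lineCoordinates_injective {f : ℝ × ℝ →ₗ[ℝ] ℝ} (hf : 0 < f (1, 0) ^ 2 + f (0, 1) ^ 2)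
    (c : ℝ) : Function.Injective (lineCoordinates f c) := by
  intro p q hpq
  simp only [lineCoordinates, Prod.mk.injEq] at hpq
  obtain ⟨h1, h2⟩ := hpq
  rw [linearMap_prod_apply f p, linearMap_prod_apply f q] at h2
  ext
  · refine mul_left_cancel₀ hf.ne' ?_
    linear_combination f (1, 0) * h2 - f (0, 1) * h1
  · refine mul_left_cancel₀ hf.ne' ?_
    linear_combination f (0, 1) * h2 + f (1, 0) * h1

theorem continuous_lineCoordinates (f : ℝ × ℝ →ₗ[ℝ] ℝ) (c : ℝ) :
    Continuous (lineCoordinates f c) := by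
  have := f.continuous_of_finiteDimensional
  unfold lineCoordinates
  fun_prop

theorem convex_image_lineCoordinates (f : ℝ × ℝ →ₗ[ℝ] ℝ) (c : ℝ) {C : Set (ℝ × ℝ)}
    (hC : Convex ℝ C) : Convex ℝ (lineCoordinates f c '' C) := by
  rintro _ ⟨p, hp, rfl⟩ _ ⟨q, hq, rfl⟩ a b ha hb hab
  refine ⟨a • p + b • q, hC hp hq ha hb hab, ?_⟩
  ext
  · simp only [lineCoordinates, Prod.fst_add, Prod.smul_fst, Prod.snd_add, Prod.smul_snd,
      smul_eq_mul]
    ring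
  · simp only [lineCoordinates, map_add, map_smul, Prod.snd_add, Prod.smul_snd, smul_eq_mul]
    linear_combination c * hab

theorem exists_lineCoordinates_eq {f : ℝ × ℝ →ₗ[ℝ] ℝ} (hf : 0 < f (1, 0) ^ 2 + f (0, 1) ^ 2)
    (c : ℝ) (g : ℝ × ℝ →ₗ[ℝ] ℝ) : ∃ a b : ℝ, ∀ p,
      g p = a * (lineCoordinates f c p).1 + b * (lineCoordinates f c p).2 + b * c := by
  refine ⟨(f (1, 0) * g (0, 1) - f (0, 1) * g (1, 0)) / (f (1, 0) ^ 2 + f (0, 1) ^ 2),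
    (f (1, 0) * g (1, 0) + f (0, 1) * g (0, 1)) / (f (1, 0) ^ 2 + f (0, 1) ^ 2), fun p => ?_⟩
  simp only [lineCoordinates]
  rw [linearMap_prod_apply f p, linearMap_prod_apply g p]
  field_simp
  ring

theorem exists_heavy_pair {n M : ℕ} (hn : 18 * M < n) (hn2 : 2 ≤ n) (C : Fin n → Set (ℝ × ℝ))
    (hne : ∀ i, (C i).Nonempty) (hcpt : ∀ i, IsCompact (C i)) (hconv : ∀ i, Convex ℝ (C i))
    (hdis : ∀ i j, i ≠ j → C i ∩ C j = ∅)
    (hsep : ∀ i j, i ≠ j → ∃ (f : ℝ × ℝ →ₗ[ℝ] ℝ) (c : ℝ),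
      (∀ p ∈ C i, f p < c) ∧ (∀ p ∈ C j, c < f p) ∧
      {k | ∀ p ∈ C k, c < f p}.ncard ≤ M ∧ {k | ∀ p ∈ C k, f p < c}.ncard ≤ M) : False := by
  classical
  obtain ⟨f, c, hf0, hf1, hR, hL⟩ := hsep ⟨0, by omega⟩ ⟨1, by omega⟩ (by simp)
  have hM : 1 ≤ M := by
    refine le_trans ?_ hR
    exact (Set.ncard_pos (Set.toFinite _)).2 ⟨⟨1, by omega⟩, hf1⟩
  have hf : 0 < f (1, 0) ^ 2 + f (0, 1) ^ 2 := by
    obtain ⟨p, hp⟩ := hne ⟨0, by omega⟩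
    obtain ⟨q, hq⟩ := hne ⟨1, by omega⟩
    have h := (hf0 p hp).trans (hf1 q hq)
    rw [linearMap_prod_apply f p, linearMap_prod_apply f q] at h
    by_contra! h0
    have h1 : f (1, 0) = 0 := by nlinarith [sq_nonneg (f (1, 0)), sq_nonneg (f (0, 1))]
    have h2 : f (0, 1) = 0 := by nlinarith [sq_nonneg (f (1, 0)), sq_nonneg (f (0, 1))]
    simp [h1, h2] at h
  obtain ⟨T, hT⟩ : ∃ T : Finset (Fin n),
      T = (Finset.univ.filter fun k => ∃ p ∈ C k, f p = c) := ⟨_, rfl⟩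
  have hTc : 10 * M + 7 ≤ T.card := by
    simp only [Set.ncard_eq_toFinset_card', Set.toFinset_ofPred] at hL hR
    have hcover : (Finset.univ : Finset (Fin n)) ⊆ T ∪
        ((Finset.univ.filter fun k => ∀ p ∈ C k, f p < c) ∪
          Finset.univ.filter fun k => ∀ p ∈ C k, c < f p) := by
      intro k _
      by_cases hk : ∃ p ∈ C k, f p = c
      · exact Finset.mem_union_left _ (by simpa [hT] using hk)
      · push Not at hk
        rcases (hconv k).all_lt_or_all_gt f hk with h | h
        · exact Finset.mem_union_right _ (Finset.mem_union_left _ (by simpa using h))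
        · exact Finset.mem_union_right _ (Finset.mem_union_right _ (by simpa using h))
    have := (Finset.card_le_card hcover).trans ((Finset.card_union_le _ _).trans
      (Nat.add_le_add_left (Finset.card_union_le _ _) _))
    rw [Finset.card_univ, Fintype.card_fin] at this
    omega
  have hx : ∀ k, ∃ x : ℝ, k ∈ T → (x, 0) ∈ lineCoordinates f c '' C k := by
    intro k
    by_cases hk : ∃ p ∈ C k, f p = c
    · obtain ⟨p, hp, hpc⟩ := hk
      exact ⟨_, fun _ => ⟨p, hp, Prod.ext rfl (by simp [lineCoordinates, hpc])⟩⟩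
    · exact ⟨0, fun h => absurd (by simpa [hT] using h) hk⟩
  choose x hx using hx
  have hdisj : ∀ i j, i ≠ j → Disjoint (lineCoordinates f c '' C i) (lineCoordinates f c '' C j) :=
    fun i j hij => (Set.disjoint_image_iff (lineCoordinates_injective hf c)).2
      (Set.disjoint_iff_inter_eq_empty.2 (hdis i j hij))
  obtain ⟨e, heT, hmono⟩ := exists_strictMono_enumeration T x fun i hi j hj hij => by
    by_contra hne'
    have := hx j hj
    rw [← hij] at this
    exact Set.disjoint_left.1 (hdisj i j hne') (hx i hi) this
  have hinj : Function.Injective e := hmono.injective.of_comp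
  refine exists_heavy_separator hTc (S := fun i => lineCoordinates f c '' C (e i)) hmono
    (fun i => hx _ (heT i)) (fun i => convex_image_lineCoordinates f c (hconv _))
    (fun i => (hcpt _).image (continuous_lineCoordinates f c))
    (fun i j hij => hdisj _ _ (hinj.ne hij)) fun i j hij => ?_
  obtain ⟨g, d, hgi, hgj, hgR, hgL⟩ := hsep (e i) (e j) (hinj.ne hij.ne)
  obtain ⟨a, b, hab⟩ := exists_lineCoordinates_eq hf c g
  have ha : 0 < a := by
    obtain ⟨p, hp, hpx⟩ := hx _ (heT i)
    obtain ⟨q, hq, hqx⟩ := hx _ (heT j)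
    have h1 := (hgi p hp).trans (hgj q hq)
    rw [hab, hab, hpx, hqx] at h1
    have h2 : x (e i) < x (e j) := hmono hij
    nlinarith
  have hlt : ∀ p, (lineCoordinates f c p).1 + b / a * (lineCoordinates f c p).2 < (d - b * c) / a ↔
      g p < d := by
    intro p
    rw [lt_div_iff₀ ha, hab]
    have : ((lineCoordinates f c p).1 + b / a * (lineCoordinates f c p).2) * a =
      a * (lineCoordinates f c p).1 + b * (lineCoordinates f c p).2 := by field_simp
    rw [this, lt_sub_iff_add_lt]
  have hgt : ∀ p, (d - b * c) / a < (lineCoordinates f c p).1 + b / a * (lineCoordinates f c p).2 ↔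
      d < g p := by
    intro p
    rw [div_lt_iff₀ ha, hab]
    have : ((lineCoordinates f c p).1 + b / a * (lineCoordinates f c p).2) * a =
      a * (lineCoordinates f c p).1 + b * (lineCoordinates f c p).2 := by field_simp
    rw [this, sub_lt_iff_lt_add]
  refine ⟨(d - b * c) / a, b / a, ?_, ?_, ?_, ?_⟩
  · simpa only [Set.forall_mem_image, hlt] using hgi
  · simpa only [Set.forall_mem_image, hgt] using hgj
  · simp only [Set.forall_mem_image, hlt]
    exact (Set.ncard_le_ncard_of_injOn e (fun k hk => hk) hinj.injOn (Set.toFinite _)).trans hgL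
  · simp only [Set.forall_mem_image, hgt]
    exact (Set.ncard_le_ncard_of_injOn e (fun k hk => hk) hinj.injOn (Set.toFinite _)).trans hgR

/-- Main theorem: among `n ≥ 2` pairwise disjoint compact convex plane sets there is a pair
`C i`, `C j` such that every line (affine functional `f`, constant `c`) separating `C i` from
`C j` has at least `n/18` of the sets entirely on one of its two sides. -/
theorem stmt_4 (n : ℕ) (hn : 2 ≤ n) (C : Fin n → Set (ℝ × ℝ))
    (hne : ∀ i, (C i).Nonempty)
    (hcpt : ∀ i, IsCompact (C i)) (hconv : ∀ i, Convex ℝ (C i))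
    (hdis : ∀ i j, i ≠ j → C i ∩ C j = ∅) :
    ∃ i j : Fin n, i ≠ j ∧
      ∀ (f : ℝ × ℝ →ₗ[ℝ] ℝ) (c : ℝ),
        (∀ p ∈ C i, f p < c) → (∀ p ∈ C j, c < f p) →
        ((n : ℝ) / 18 ≤ ({k : Fin n | ∀ p ∈ C k, c < f p}.ncard : ℝ) ∨
         (n : ℝ) / 18 ≤ ({k : Fin n | ∀ p ∈ C k, f p < c}.ncard : ℝ)) := by
  have hM : ∀ m : ℕ, (m : ℝ) < (n : ℝ) / 18 → m ≤ (n - 1) / 18 := by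
    intro m hm
    rw [lt_div_iff₀ (by norm_num)] at hm
    have : m * 18 < n := by exact_mod_cast hm
    omega
  by_contra! h
  refine exists_heavy_pair (M := (n - 1) / 18) (by omega) hn C hne hcpt hconv hdis
    fun i j hij => ?_
  obtain ⟨f, c, h1, h2, h3, h4⟩ := h i j hij
  exact ⟨f, c, h1, h2, hM _ h3, hM _ h4⟩
end

section
/- Let C be a finite family of n ≥ 2 pairwise disjoint compact convex sets in the plane, and suppose every line separating any fixed pair A, B ∈ C leaves fewer than n/18 sets of C strictly on each side together with A or B respectively. Then n < 2, a contradiction; equivalently, the bound n/18 in the main theorem cannot be improved to hold vacuously—formally: it is not the case that for all pairs A ≠ B in C there exists a separating line l with both open halfplanes of l containing fewer than ⌈n/18⌉ sets of C. -/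
/-- If every two elements of `V` are related by `N` in at least one direction and each element is
related to at most `d` others, then `V` has at most `2 * d + 1` elements. -/
theorem card_le_of_mem_or_mem {ι : Type*} [DecidableEq ι] (V : Finset ι) (N : ι → Finset ι) (d : ℕ)
    (hd : ∀ x ∈ V, (N x).card ≤ d)
    (hN : ∀ a ∈ V, ∀ b ∈ V, a ≠ b → b ∈ N a ∨ a ∈ N b) : V.card ≤ 2 * d + 1 := by
  have hsub : V.offDiag ⊆
      (V.sigma N).image (fun z => (z.1, z.2)) ∪ (V.sigma N).image (fun z => (z.2, z.1)) := by
    rintro ⟨a, b⟩ hab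
    rw [Finset.mem_offDiag] at hab
    obtain ⟨ha, hb, hne⟩ := hab
    rw [Finset.mem_union, Finset.mem_image, Finset.mem_image]
    rcases hN a ha b hb hne with h | h
    · exact Or.inl ⟨⟨a, b⟩, Finset.mem_sigma.2 ⟨ha, h⟩, rfl⟩
    · exact Or.inr ⟨⟨b, a⟩, Finset.mem_sigma.2 ⟨hb, h⟩, rfl⟩
  have h1 : (V.sigma N).card ≤ V.card * d := by
    rw [Finset.card_sigma]
    exact Finset.sum_le_card_nsmul _ _ _ hd
  have h2 := (Finset.card_le_card hsub).trans (Finset.card_union_le _ _)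
  have h3 := Finset.card_image_le (s := V.sigma N) (f := fun z => (z.1, z.2))
  have h4 := Finset.card_image_le (s := V.sigma N) (f := fun z => (z.2, z.1))
  rw [Finset.offDiag_card] at h2
  by_contra! hlt
  have h5 : V.card * V.card ≤ V.card * (2 * d + 1) := by
    have : V.card * (2 * d + 1) = V.card * d + V.card * d + V.card := by ring
    omega
  have := Nat.le_of_mul_le_mul_left h5 (by omega)
  omega

/-- Combinatorial data of planar sets meeting the vertical axis, in the order given by `y`, with
right and left extents `r` and `l`, and of lines separating them: `σ i j` is the slope of the line
separating `i` from `j`, and `up i j`, `down i j` are the sets above and below that line. -/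
structure SlopeSystem {ι : Type*} (F : Finset ι) (M : ℕ) (y r l : ι → ℝ) (σ : ι → ι → ℝ)
    (up down : ι → ι → Finset ι) : Prop where
  inj : ∀ i ∈ F, ∀ j ∈ F, y i = y j → i = j
  mem_up : ∀ i ∈ F, ∀ j ∈ F, y i < y j → j ∈ up i j
  mem_down : ∀ i ∈ F, ∀ j ∈ F, y i < y j → i ∈ down i j
  card_up : ∀ i ∈ F, ∀ j ∈ F, y i < y j → (up i j).card ≤ M
  card_down : ∀ i ∈ F, ∀ j ∈ F, y i < y j → (down i j).card ≤ M
  up_r : ∀ i ∈ F, ∀ j ∈ F, ∀ k ∈ F, y i < y j → y j < y k → r k ≤ r j →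
    σ j k ≤ σ i j → k ∈ up i j
  up_l : ∀ i ∈ F, ∀ j ∈ F, ∀ k ∈ F, y i < y j → y j < y k → l k ≤ l j →
    σ i j ≤ σ j k → k ∈ up i j
  down_r : ∀ i ∈ F, ∀ j ∈ F, ∀ k ∈ F, y i < y j → y j < y k → r i ≤ r j →
    σ j k ≤ σ i j → i ∈ down j k
  down_l : ∀ i ∈ F, ∀ j ∈ F, ∀ k ∈ F, y i < y j → y j < y k → l i ≤ l j →
    σ i j ≤ σ j k → i ∈ down j k

namespace SlopeSystem

variable {ι : Type*} {F : Finset ι} {M : ℕ} {y r l : ι → ℝ} {σ : ι → ι → ℝ}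
  {up down : ι → ι → Finset ι}

/-- Reflection in the vertical axis. -/
theorem swap (S : SlopeSystem F M y r l σ up down) :
    SlopeSystem F M y l r (fun i j => -σ i j) up down where
  inj := S.inj
  mem_up := S.mem_up
  mem_down := S.mem_down
  card_up := S.card_up
  card_down := S.card_down
  up_r i hi j hj k hk h1 h2 h3 h4 := S.up_l i hi j hj k hk h1 h2 h3 (by linarith)
  up_l i hi j hj k hk h1 h2 h3 h4 := S.up_r i hi j hj k hk h1 h2 h3 (by linarith)
  down_r i hi j hj k hk h1 h2 h3 h4 := S.down_l i hi j hj k hk h1 h2 h3 (by linarith)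
  down_l i hi j hj k hk h1 h2 h3 h4 := S.down_r i hi j hj k hk h1 h2 h3 (by linarith)

/-- Reflection in the horizontal axis. -/
theorem reverse (S : SlopeSystem F M y r l σ up down) :
    SlopeSystem F M (fun i => -y i) r l (fun i j => -σ j i) (fun i j => down j i)
      (fun i j => up j i) where
  inj i hi j hj h := S.inj i hi j hj (neg_injective h)
  mem_up i hi j hj h := S.mem_down j hj i hi (neg_lt_neg_iff.1 h)
  mem_down i hi j hj h := S.mem_up j hj i hi (neg_lt_neg_iff.1 h)
  card_up i hi j hj h := S.card_down j hj i hi (neg_lt_neg_iff.1 h)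
  card_down i hi j hj h := S.card_up j hj i hi (neg_lt_neg_iff.1 h)
  up_r i hi j hj k hk h1 h2 h3 h4 :=
    S.down_r k hk j hj i hi (neg_lt_neg_iff.1 h2) (neg_lt_neg_iff.1 h1) h3 (by linarith)
  up_l i hi j hj k hk h1 h2 h3 h4 :=
    S.down_l k hk j hj i hi (neg_lt_neg_iff.1 h2) (neg_lt_neg_iff.1 h1) h3 (by linarith)
  down_r i hi j hj k hk h1 h2 h3 h4 :=
    S.up_r k hk j hj i hi (neg_lt_neg_iff.1 h2) (neg_lt_neg_iff.1 h1) h3 (by linarith)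
  down_l i hi j hj k hk h1 h2 h3 h4 :=
    S.up_l k hk j hj i hi (neg_lt_neg_iff.1 h2) (neg_lt_neg_iff.1 h1) h3 (by linarith)

open Classical in
theorem card_lower_lt_or_card_upper_lt (S : SlopeSystem F M y r l σ up down) (hM : 0 < M)
    {j : ι} (hj : j ∈ F) :
    (F.filter fun i => y i < y j ∧ r i ≤ r j).card < M ∨
      (F.filter fun k => y j < y k ∧ l k ≤ l j).card < M := by
  by_contra! h
  obtain ⟨hI, hK⟩ := h
  obtain ⟨k, hk, hmin⟩ := Finset.exists_min_image _ (σ j) (Finset.card_pos.1 (hM.trans_le hK))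
  rw [Finset.mem_filter] at hk
  obtain ⟨hkF, hjk, -⟩ := hk
  have hi : ∃ i ∈ F.filter (fun i => y i < y j ∧ r i ≤ r j), σ i j < σ j k := by
    by_contra! hge
    have hsub : insert j (F.filter fun i => y i < y j ∧ r i ≤ r j) ⊆ down j k := by
      intro i hi
      rcases Finset.mem_insert.1 hi with rfl | hi
      · exact S.mem_down i hj k hkF hjk
      · have := hge i hi
        rw [Finset.mem_filter] at hi
        exact S.down_r i hi.1 j hj k hkF hi.2.1 hjk hi.2.2 this
    have h1 := (Finset.card_le_card hsub).trans (S.card_down j hj k hkF hjk)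
    rw [Finset.card_insert_of_notMem (by simp)] at h1
    omega
  obtain ⟨i, hi, hik⟩ := hi
  rw [Finset.mem_filter] at hi
  have hsub : insert j (F.filter fun k => y j < y k ∧ l k ≤ l j) ⊆ up i j := by
    intro k' hk'
    rcases Finset.mem_insert.1 hk' with rfl | hk'
    · exact S.mem_up i hi.1 k' hj hi.2.1
    · have := hmin k' hk'
      rw [Finset.mem_filter] at hk'
      exact S.up_l i hi.1 j hj k' hk'.1 hi.2.1 hk'.2.1 hk'.2.2 (by linarith)
  have h1 := (Finset.card_le_card hsub).trans (S.card_up i hi.1 j hj hi.2.1)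
  rw [Finset.card_insert_of_notMem (by simp)] at h1
  omega

open Classical in
theorem card_dominated_lt (S : SlopeSystem F M y r l σ up down) {i j : ι} (hi : i ∈ F)
    (hj : j ∈ F) (hij : y i < y j) :
    (F.filter fun k => y j < y k ∧ r k ≤ r j ∧ l k ≤ l j).card < M := by
  have hsub : insert j (F.filter fun k => y j < y k ∧ r k ≤ r j ∧ l k ≤ l j) ⊆ up i j := by
    intro k hk
    rcases Finset.mem_insert.1 hk with rfl | hk
    · exact S.mem_up i hi k hj hij
    · rw [Finset.mem_filter] at hk
      obtain ⟨hkF, hjk, hr, hl⟩ := hk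
      rcases le_total (σ i j) (σ j k) with h | h
      · exact S.up_l i hi j hj k hkF hij hjk hl h
      · exact S.up_r i hi j hj k hkF hij hjk hr h
  have h1 := (Finset.card_le_card hsub).trans (S.card_up i hi j hj hij)
  rw [Finset.card_insert_of_notMem (by simp)] at h1
  omega

open Classical in
theorem card_few_lower (S : SlopeSystem F M y r l σ up down) :
    (F.filter fun j => (F.filter fun i => y i < y j ∧ r i ≤ r j).card < M ∧
      (F.filter fun i => y i < y j ∧ l i ≤ l j).card < M).card + 4 ≤ 6 * M ∨ F = ∅ ∨ M = 0 := by
  rcases F.eq_empty_or_nonempty with hF | hF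
  · exact Or.inr (Or.inl hF)
  rcases Nat.eq_zero_or_pos M with hM | hM
  · exact Or.inr (Or.inr hM)
  left
  obtain ⟨b, hb, hmin⟩ := Finset.exists_min_image F y hF
  set V := F.filter fun j => (F.filter fun i => y i < y j ∧ r i ≤ r j).card < M ∧
      (F.filter fun i => y i < y j ∧ l i ≤ l j).card < M with hV
  have key : (V.erase b).card ≤ 2 * (3 * (M - 1)) + 1 := by
    refine card_le_of_mem_or_mem (V.erase b) (fun x =>
      (F.filter fun i => y i < y x ∧ r i ≤ r x) ∪ (F.filter fun i => y i < y x ∧ l i ≤ l x) ∪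
        (F.filter fun k => y x < y k ∧ r k ≤ r x ∧ l k ≤ l x)) _ ?_ ?_
    · intro x hx
      rw [Finset.mem_erase, hV, Finset.mem_filter] at hx
      obtain ⟨hxb, hxF, h1, h2⟩ := hx
      have hbx : y b < y x :=
        lt_of_le_of_ne (hmin x hxF) fun h => hxb (S.inj b hb x hxF h).symm
      have h3 := S.card_dominated_lt hb hxF hbx
      have h4 := Finset.card_union_le
        ((F.filter fun i => y i < y x ∧ r i ≤ r x) ∪ (F.filter fun i => y i < y x ∧ l i ≤ l x))
        (F.filter fun k => y x < y k ∧ r k ≤ r x ∧ l k ≤ l x)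
      have h5 := Finset.card_union_le
        (F.filter fun i => y i < y x ∧ r i ≤ r x) (F.filter fun i => y i < y x ∧ l i ≤ l x)
      omega
    · have main : ∀ a ∈ F, ∀ c ∈ F, y a < y c →
          (c ∈ F.filter fun k => y a < y k ∧ r k ≤ r a ∧ l k ≤ l a) ∨
          (a ∈ (F.filter fun i => y i < y c ∧ r i ≤ r c) ∪
            (F.filter fun i => y i < y c ∧ l i ≤ l c)) := by
        intro a ha c hc hac
        simp only [Finset.mem_union, Finset.mem_filter, ha, hc, hac, true_and]
        rcases le_total (r a) (r c) with h | h
        · exact Or.inr (Or.inl h)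
        · rcases le_total (l a) (l c) with h' | h'
          · exact Or.inr (Or.inr h')
          · exact Or.inl ⟨h, h'⟩
      intro a ha c hc hne
      have haF := (Finset.mem_filter.1 (Finset.mem_of_mem_erase ha)).1
      have hcF := (Finset.mem_filter.1 (Finset.mem_of_mem_erase hc)).1
      rcases lt_trichotomy (y a) (y c) with h | h | h
      · rcases main a haF c hcF h with h | h
        · exact Or.inl (Finset.mem_union_right _ h)
        · exact Or.inr (Finset.mem_union_left _ h)
      · exact absurd (S.inj a haF c hcF h) hne
      · rcases main c hcF a haF h with h | h
        · exact Or.inr (Finset.mem_union_right _ h)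
        · exact Or.inl (Finset.mem_union_left _ h)
  have := Finset.pred_card_le_card_erase (s := V) (a := b)
  omega

open Classical in
theorem card_few_r (S : SlopeSystem F M y r l σ up down) :
    (F.filter fun j => (F.filter fun i => y i < y j ∧ r i ≤ r j).card < M ∧
      (F.filter fun k => y j < y k ∧ r k ≤ r j).card < M).card ≤ 2 * M := by
  set V := F.filter fun j => (F.filter fun i => y i < y j ∧ r i ≤ r j).card < M ∧
      (F.filter fun k => y j < y k ∧ r k ≤ r j).card < M with hV
  rcases V.eq_empty_or_nonempty with h | h
  · simp [h]
  obtain ⟨j, hj, hmax⟩ := Finset.exists_max_image V r h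
  have hsub : V ⊆ insert j ((F.filter fun i => y i < y j ∧ r i ≤ r j) ∪
      (F.filter fun k => y j < y k ∧ r k ≤ r j)) := by
    intro i hi
    have hr := hmax i hi
    have hiF := (Finset.mem_filter.1 hi).1
    have hjF := (Finset.mem_filter.1 hj).1
    simp only [Finset.mem_insert, Finset.mem_union, Finset.mem_filter, hiF, hr, true_and, and_true]
    rcases lt_trichotomy (y i) (y j) with h | h | h
    · exact Or.inr (Or.inl h)
    · exact Or.inl (S.inj i hiF j hjF h)
    · exact Or.inr (Or.inr h)
  have h1 := (Finset.card_le_card hsub).trans (Finset.card_insert_le _ _)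
  have h2 := Finset.card_union_le (F.filter fun i => y i < y j ∧ r i ≤ r j)
      (F.filter fun k => y j < y k ∧ r k ≤ r j)
  rw [hV, Finset.mem_filter] at hj
  omega

open Classical in
theorem card_le (S : SlopeSystem F M y r l σ up down) (hM : 0 < M) : F.card ≤ 16 * M := by
  rcases F.eq_empty_or_nonempty with hF | hF
  · simp [hF]
  have h1 := S.card_few_r
  have h2 := S.swap.card_few_r
  have h3 := S.card_few_lower
  have h4 := S.reverse.card_few_lower
  simp only [neg_lt_neg_iff, hF.ne_empty, hM.ne', or_false] at h3 h4
  have hsub : F ⊆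
      ((F.filter fun j => (F.filter fun i => y i < y j ∧ r i ≤ r j).card < M ∧
        (F.filter fun k => y j < y k ∧ r k ≤ r j).card < M) ∪
      (F.filter fun j => (F.filter fun i => y i < y j ∧ l i ≤ l j).card < M ∧
        (F.filter fun k => y j < y k ∧ l k ≤ l j).card < M)) ∪
      ((F.filter fun j => (F.filter fun i => y i < y j ∧ r i ≤ r j).card < M ∧
        (F.filter fun i => y i < y j ∧ l i ≤ l j).card < M) ∪
      (F.filter fun j => (F.filter fun k => y j < y k ∧ r k ≤ r j).card < M ∧
        (F.filter fun k => y j < y k ∧ l k ≤ l j).card < M)) := by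
    intro j hj
    have h5 := S.card_lower_lt_or_card_upper_lt hM hj
    have h6 := S.swap.card_lower_lt_or_card_upper_lt hM hj
    simp only [Finset.mem_union, Finset.mem_filter (s := F) (a := j), hj, true_and]
    tauto
  have h7 := Finset.card_le_card hsub
  have h8 := h7.trans (Finset.card_union_le _ _)
  have h9 := h8.trans (Nat.add_le_add (Finset.card_union_le _ _) (Finset.card_union_le _ _))
  omega

end SlopeSystem

/-- Two chords over the same interval that change order belong to sets with a common point. -/
theorem lt_of_disjoint_of_lt {X Y : Set (ℝ × ℝ)} (hX : Convex ℝ X) (hY : Convex ℝ Y)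
    (hXY : X ∩ Y = ∅) {x a b c d : ℝ} (ha : ((0 : ℝ), a) ∈ X) (hb : (x, b) ∈ X)
    (hc : ((0 : ℝ), c) ∈ Y) (hd : (x, d) ∈ Y) (hca : c < a) : d < b := by
  by_contra! hbd
  have hpos : 0 < (a - c) + (d - b) := by linarith
  set u := (d - b) / ((a - c) + (d - b)) with hu
  set v := (a - c) / ((a - c) + (d - b)) with hv
  have hu0 : 0 ≤ u := div_nonneg (by linarith) hpos.le
  have hv0 : 0 ≤ v := div_nonneg (by linarith) hpos.le
  have huv : u + v = 1 := by rw [hu, hv]; field_simp; ring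
  have h1 := hX ha hb hu0 hv0 huv
  have h2 := hY hc hd hu0 hv0 huv
  have heq : u • ((0 : ℝ), a) + v • (x, b) = u • ((0 : ℝ), c) + v • (x, d) := by
    ext
    · simp
    · simp only [Prod.snd_add, Prod.smul_snd, smul_eq_mul, hu, hv]
      field_simp
      ring
  rw [← heq] at h2
  exact Set.notMem_empty _ (hXY ▸ Set.mem_inter h1 h2)

theorem exists_mem_of_mem_uIcc {Y : Set (ℝ × ℝ)} (hY : Convex ℝ Y) {c x : ℝ} {z : ℝ × ℝ}
    (hc : ((0 : ℝ), c) ∈ Y) (hz : z ∈ Y) (hx : x ∈ Set.uIcc 0 z.1) : ∃ d, (x, d) ∈ Y := by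
  rw [← segment_eq_uIcc] at hx
  obtain ⟨u, v, hu, hv, huv, rfl⟩ := hx
  exact ⟨u * c + v * z.2, hY hc hz hu hv huv⟩

theorem notMem_uIcc_of_above {X Y : Set (ℝ × ℝ)} (hX : Convex ℝ X) (hY : Convex ℝ Y)
    (hXY : X ∩ Y = ∅) {a c s t : ℝ} (ha : ((0 : ℝ), a) ∈ X) (hc : ((0 : ℝ), c) ∈ Y) (hca : c < a)
    (hYline : ∀ p ∈ Y, s * p.1 + t < p.2) {q z : ℝ × ℝ} (hq : q ∈ X) (hqline : q.2 ≤ s * q.1 + t)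
    (hz : z ∈ Y) : q.1 ∉ Set.uIcc 0 z.1 := by
  intro hx
  obtain ⟨d, hd⟩ := exists_mem_of_mem_uIcc hY hc hz hx
  have h1 := lt_of_disjoint_of_lt hX hY hXY ha hq hc hd hca
  have h2 := hYline _ hd
  simp only at h2
  linarith

theorem notMem_uIcc_of_below {X Y : Set (ℝ × ℝ)} (hX : Convex ℝ X) (hY : Convex ℝ Y)
    (hXY : Y ∩ X = ∅) {a c s t : ℝ} (ha : ((0 : ℝ), a) ∈ X) (hc : ((0 : ℝ), c) ∈ Y) (hac : a < c)
    (hYline : ∀ p ∈ Y, p.2 < s * p.1 + t) {q z : ℝ × ℝ} (hq : q ∈ X) (hqline : s * q.1 + t ≤ q.2)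
    (hz : z ∈ Y) : q.1 ∉ Set.uIcc 0 z.1 := by
  intro hx
  obtain ⟨d, hd⟩ := exists_mem_of_mem_uIcc hY hc hz hx
  have h1 := lt_of_disjoint_of_lt hY hX hXY hc hd ha hq hac
  have h2 := hYline _ hd
  simp only at h2
  linarith

open Classical in
/-- Pairwise disjoint convex sets meeting the vertical axis, each two of which are separated by a
line having at most `M` of the sets on each side, are at most `16 * M` in number. -/
theorem card_le_of_separated {ι : Type*} (F : Finset ι) (M : ℕ) (hM : 0 < M)
    (D : ι → Set (ℝ × ℝ)) (hconv : ∀ i, Convex ℝ (D i)) (hdis : ∀ i j, i ≠ j → D i ∩ D j = ∅)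
    (y r l : ι → ℝ) (hy : ∀ i ∈ F, ((0 : ℝ), y i) ∈ D i)
    (hr : ∀ i, ∀ p ∈ D i, p.1 ≤ r i) (hr' : ∀ i, ∃ p ∈ D i, p.1 = r i)
    (hl : ∀ i, ∀ p ∈ D i, -p.1 ≤ l i) (hl' : ∀ i, ∃ p ∈ D i, -p.1 = l i)
    (hsep : ∀ i ∈ F, ∀ j ∈ F, y i < y j → ∃ s t : ℝ,
      (∀ p ∈ D i, p.2 < s * p.1 + t) ∧ (∀ p ∈ D j, s * p.1 + t < p.2) ∧
      (F.filter fun k => ∀ p ∈ D k, p.2 < s * p.1 + t).card ≤ M ∧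
      (F.filter fun k => ∀ p ∈ D k, s * p.1 + t < p.2).card ≤ M) :
    F.card ≤ 16 * M := by
  have hsep' : ∀ i j, ∃ s t : ℝ, i ∈ F → j ∈ F → y i < y j →
      (∀ p ∈ D i, p.2 < s * p.1 + t) ∧ (∀ p ∈ D j, s * p.1 + t < p.2) ∧
      (F.filter fun k => ∀ p ∈ D k, p.2 < s * p.1 + t).card ≤ M ∧
      (F.filter fun k => ∀ p ∈ D k, s * p.1 + t < p.2).card ≤ M := by
    intro i j
    by_cases h : i ∈ F ∧ j ∈ F ∧ y i < y j
    · obtain ⟨s, t, hst⟩ := hsep i h.1 j h.2.1 h.2.2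
      exact ⟨s, t, fun _ _ _ => hst⟩
    · exact ⟨0, 0, fun h1 h2 h3 => absurd ⟨h1, h2, h3⟩ h⟩
  choose s t hst using hsep'
  have hne : ∀ {i j}, y i < y j → i ≠ j := fun h he => h.ne (congrArg y he)
  have hgap : ∀ i ∈ F, ∀ j ∈ F, ∀ k ∈ F, y i < y j → y j < y k → t i j < t j k := by
    intro i hi j hj k hk hij hjk
    have h1 := (hst i j hi hj hij).2.1 _ (hy j hj)
    have h2 := (hst j k hj hk hjk).1 _ (hy j hj)
    simp only [mul_zero, zero_add] at h1 h2
    exact h1.trans h2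
  refine SlopeSystem.card_le (y := y) (r := r) (l := l) (σ := s)
    (up := fun i j => F.filter fun k => ∀ p ∈ D k, s i j * p.1 + t i j < p.2)
    (down := fun i j => F.filter fun k => ∀ p ∈ D k, p.2 < s i j * p.1 + t i j) ?_ hM
  refine ⟨?_, ?_, ?_, ?_, ?_, ?_, ?_, ?_, ?_⟩
  · intro i hi j hj h
    by_contra hij
    have h1 := hy i hi
    rw [h] at h1
    exact Set.notMem_empty _ (hdis i j hij ▸ Set.mem_inter h1 (hy j hj))
  · intro i hi j hj h
    exact Finset.mem_filter.2 ⟨hj, (hst i j hi hj h).2.1⟩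
  · intro i hi j hj h
    exact Finset.mem_filter.2 ⟨hi, (hst i j hi hj h).1⟩
  · intro i hi j hj h
    exact (hst i j hi hj h).2.2.2
  · intro i hi j hj h
    exact (hst i j hi hj h).2.2.1
  · intro i hi j hj k hk hij hjk hrk hs
    refine Finset.mem_filter.2 ⟨hk, fun q hq => ?_⟩
    by_contra! hq2
    obtain ⟨z, hz, hzr⟩ := hr' j
    have h1 := notMem_uIcc_of_above (hconv k) (hconv j) (hdis k j (hne hjk).symm) (hy k hk)
      (hy j hj) hjk (hst i j hi hj hij).2.1 hq hq2 hz
    have h2 := hr k q hq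
    have h3 : q.1 < 0 := by
      by_contra! h
      exact h1 (Set.mem_uIcc_of_le h (by linarith))
    have h4 := (hst j k hj hk hjk).2.1 q hq
    have h5 := hgap i hi j hj k hk hij hjk
    nlinarith
  · intro i hi j hj k hk hij hjk hlk hs
    refine Finset.mem_filter.2 ⟨hk, fun q hq => ?_⟩
    by_contra! hq2
    obtain ⟨z, hz, hzl⟩ := hl' j
    have h1 := notMem_uIcc_of_above (hconv k) (hconv j) (hdis k j (hne hjk).symm) (hy k hk)
      (hy j hj) hjk (hst i j hi hj hij).2.1 hq hq2 hz
    have h2 := hl k q hq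
    have h3 : 0 < q.1 := by
      by_contra! h
      exact h1 (Set.mem_uIcc_of_ge (by linarith) h)
    have h4 := (hst j k hj hk hjk).2.1 q hq
    have h5 := hgap i hi j hj k hk hij hjk
    nlinarith
  · intro i hi j hj k hk hij hjk hri hs
    refine Finset.mem_filter.2 ⟨hi, fun q hq => ?_⟩
    by_contra! hq2
    obtain ⟨z, hz, hzr⟩ := hr' j
    have h1 := notMem_uIcc_of_below (hconv i) (hconv j) (hdis j i (hne hij).symm) (hy i hi)
      (hy j hj) hij (hst j k hj hk hjk).1 hq hq2 hz
    have h2 := hr i q hq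
    have h3 : q.1 < 0 := by
      by_contra! h
      exact h1 (Set.mem_uIcc_of_le h (by linarith))
    have h4 := (hst i j hi hj hij).1 q hq
    have h5 := hgap i hi j hj k hk hij hjk
    nlinarith
  · intro i hi j hj k hk hij hjk hli hs
    refine Finset.mem_filter.2 ⟨hi, fun q hq => ?_⟩
    by_contra! hq2
    obtain ⟨z, hz, hzl⟩ := hl' j
    have h1 := notMem_uIcc_of_below (hconv i) (hconv j) (hdis j i (hne hij).symm) (hy i hi)
      (hy j hj) hij (hst j k hj hk hjk).1 hq hq2 hz
    have h2 := hl i q hq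
    have h3 : 0 < q.1 := by
      by_contra! h
      exact h1 (Set.mem_uIcc_of_ge (by linarith) h)
    have h4 := (hst i j hi hj hij).1 q hq
    have h5 := hgap i hi j hj k hk hij hjk
    nlinarith

theorem exists_eq_of_convex {E : Type*} [AddCommGroup E] [Module ℝ E] {C : Set E}
    (hC : Convex ℝ C) (f : E →ₗ[ℝ] ℝ) {c : ℝ} (h1 : ∃ p ∈ C, c ≤ f p) (h2 : ∃ p ∈ C, f p ≤ c) :
    ∃ p ∈ C, f p = c := by
  obtain ⟨p, hp, hpc⟩ := h1
  obtain ⟨q, hq, hqc⟩ := h2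
  exact (hC.linear_image f).ordConnected.out ⟨q, hq, rfl⟩ ⟨p, hp, rfl⟩ ⟨hqc, hpc⟩

open Classical in
/-- The sets meeting a fixed line, each two of which are separated by a line having at most `M` of
the sets on each side, are at most `16 * M` in number. -/
theorem card_meeting_line_le {ι : Type*} (F : Finset ι) (M : ℕ) (hM : 0 < M)
    (C : ι → Set (ℝ × ℝ)) (hne : ∀ i, (C i).Nonempty) (hcpt : ∀ i, IsCompact (C i))
    (hconv : ∀ i, Convex ℝ (C i)) (hdis : ∀ i j, i ≠ j → C i ∩ C j = ∅)
    (f₀ : ℝ × ℝ →ₗ[ℝ] ℝ) (c₀ : ℝ) (hf₀ : f₀ ≠ 0) (hmeet : ∀ i ∈ F, ∃ p ∈ C i, f₀ p = c₀)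
    (hsep : ∀ i ∈ F, ∀ j ∈ F, i ≠ j → ∃ (f : ℝ × ℝ →ₗ[ℝ] ℝ) (c : ℝ),
      (∀ p ∈ C i, f p < c) ∧ (∀ p ∈ C j, c < f p) ∧
      (F.filter fun k => ∀ p ∈ C k, f p < c).card ≤ M ∧
      (F.filter fun k => ∀ p ∈ C k, c < f p).card ≤ M) :
    F.card ≤ 16 * M := by
  have hcoord : ∀ (f : ℝ × ℝ →ₗ[ℝ] ℝ) (p : ℝ × ℝ), f p = f (1, 0) * p.1 + f (0, 1) * p.2 := by
    intro f p
    have : p = p.1 • ((1 : ℝ), (0 : ℝ)) + p.2 • ((0 : ℝ), (1 : ℝ)) := by ext <;> simp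
    conv_lhs => rw [this]
    rw [map_add, map_smul, map_smul, smul_eq_mul, smul_eq_mul]
    ring
  set α := f₀ (1, 0) with hα
  set β := f₀ (0, 1) with hβ
  have hpos : 0 < α ^ 2 + β ^ 2 := by
    by_contra! h
    have ha : α = 0 := by nlinarith [sq_nonneg α, sq_nonneg β]
    have hb : β = 0 := by nlinarith [sq_nonneg α, sq_nonneg β]
    refine hf₀ (LinearMap.ext fun p => ?_)
    rw [hcoord f₀ p, ← hα, ← hβ, ha, hb]
    simp
  set g : ℝ × ℝ →ₗ[ℝ] ℝ := (-β) • LinearMap.fst ℝ ℝ ℝ + α • LinearMap.snd ℝ ℝ ℝ with hg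
  have hgp : ∀ p, g p = -β * p.1 + α * p.2 := fun p => by simp [hg]
  have hfp : ∀ p, f₀ p = α * p.1 + β * p.2 := hcoord f₀
  set D : ι → Set (ℝ × ℝ) := fun i => (fun z => (-c₀, (0 : ℝ)) + z) '' (f₀.prod g '' C i) with hD
  have hmemD : ∀ i p, p ∈ C i → (f₀ p - c₀, g p) ∈ D i := by
    intro i p hp
    refine ⟨(f₀ p, g p), ⟨p, hp, rfl⟩, ?_⟩
    ext <;> simp [sub_eq_neg_add]
  have hDmem : ∀ i z, z ∈ D i → ∃ p ∈ C i, z = (f₀ p - c₀, g p) := by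
    rintro i z ⟨-, ⟨p, hp, rfl⟩, rfl⟩
    refine ⟨p, hp, ?_⟩
    ext <;> simp [sub_eq_neg_add]
  have hinj : ∀ p q, f₀ p = f₀ q → g p = g q → p = q := by
    intro p q h1 h2
    rw [hfp, hfp] at h1
    rw [hgp, hgp] at h2
    ext
    · have : (α ^ 2 + β ^ 2) * (p.1 - q.1) = 0 := by linear_combination α * h1 - β * h2
      linarith [(mul_eq_zero.1 this).resolve_left hpos.ne']
    · have : (α ^ 2 + β ^ 2) * (p.2 - q.2) = 0 := by linear_combination β * h1 + α * h2
      linarith [(mul_eq_zero.1 this).resolve_left hpos.ne']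
  have hcont : Continuous f₀ := f₀.continuous_of_finiteDimensional
  have hmax : ∀ i, ∃ p ∈ C i, ∀ q ∈ C i, f₀ q ≤ f₀ p :=
    fun i => (hcpt i).exists_isMaxOn (hne i) hcont.continuousOn
  have hmin : ∀ i, ∃ p ∈ C i, ∀ q ∈ C i, f₀ p ≤ f₀ q :=
    fun i => (hcpt i).exists_isMinOn (hne i) hcont.continuousOn
  choose pr hpr hpr' using hmax
  choose pl hpl hpl' using hmin
  have hm : ∀ i, ∃ p, i ∈ F → p ∈ C i ∧ f₀ p = c₀ := by
    intro i
    by_cases hi : i ∈ F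
    · obtain ⟨p, hp⟩ := hmeet i hi
      exact ⟨p, fun _ => hp⟩
    · exact ⟨0, fun h => absurd h hi⟩
  choose m hm using hm
  refine card_le_of_separated F M hM D (fun i => ((hconv i).linear_image _).translate _) ?_
    (fun i => g (m i)) (fun i => f₀ (pr i) - c₀) (fun i => -(f₀ (pl i) - c₀)) ?_ ?_ ?_ ?_ ?_ ?_
  · intro i j hij
    rw [Set.eq_empty_iff_forall_notMem]
    rintro z ⟨hzi, hzj⟩
    obtain ⟨p, hp, rfl⟩ := hDmem i z hzi
    obtain ⟨q, hq, hpq⟩ := hDmem j _ hzj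
    rw [Prod.mk.injEq] at hpq
    have : p = q := hinj p q (by linarith [hpq.1]) hpq.2
    subst this
    exact Set.notMem_empty _ (hdis i j hij ▸ Set.mem_inter hp hq)
  · intro i hi
    have := hmemD i _ (hm i hi).1
    rwa [(hm i hi).2, sub_self] at this
  · intro i z hz
    obtain ⟨p, hp, rfl⟩ := hDmem i z hz
    exact sub_le_sub_right (hpr' i p hp) _
  · exact fun i => ⟨_, hmemD i _ (hpr i), rfl⟩
  · intro i z hz
    obtain ⟨p, hp, rfl⟩ := hDmem i z hz
    exact neg_le_neg (sub_le_sub_right (hpl' i p hp) _)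
  · exact fun i => ⟨_, hmemD i _ (hpl i), rfl⟩
  · intro i hi j hj hij
    obtain ⟨f, c, hfi, hfj, hdown, hup⟩ := hsep i hi j hj (fun h => hij.ne (by rw [h]))
    set A := (f (1, 0) * α + f (0, 1) * β) / (α ^ 2 + β ^ 2) with hA
    set B := (f (0, 1) * α - f (1, 0) * β) / (α ^ 2 + β ^ 2) with hB
    have hfAB : ∀ p, f p = A * f₀ p + B * g p := by
      intro p
      rw [hcoord f p, hfp, hgp, hA, hB]
      field_simp
      ring
    have hBpos : 0 < B := by
      have h1 := hfi _ (hm i hi).1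
      have h2 := hfj _ (hm j hj).1
      rw [hfAB, (hm i hi).2] at h1
      rw [hfAB, (hm j hj).2] at h2
      by_contra! hneg
      nlinarith
    have hline : ∀ p, B * (-A / B * (f₀ p - c₀) + (c - A * c₀) / B) = c - A * f₀ p := by
      intro p
      field_simp
      ring
    have hbelow : ∀ k, (∀ z ∈ D k, z.2 < -A / B * z.1 + (c - A * c₀) / B) ↔
        ∀ p ∈ C k, f p < c := by
      have key : ∀ p, g p < -A / B * (f₀ p - c₀) + (c - A * c₀) / B ↔ f p < c := by
        intro p
        rw [← mul_lt_mul_iff_right₀ hBpos, hline, hfAB]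
        constructor <;> intro h <;> linarith
      intro k
      constructor
      · exact fun h p hp => (key p).1 (h _ (hmemD k p hp))
      · intro h z hz
        obtain ⟨p, hp, rfl⟩ := hDmem k z hz
        exact (key p).2 (h p hp)
    have habove : ∀ k, (∀ z ∈ D k, -A / B * z.1 + (c - A * c₀) / B < z.2) ↔
        ∀ p ∈ C k, c < f p := by
      have key : ∀ p, -A / B * (f₀ p - c₀) + (c - A * c₀) / B < g p ↔ c < f p := by
        intro p
        rw [← mul_lt_mul_iff_right₀ hBpos, hline, hfAB]
        constructor <;> intro h <;> linarith
      intro k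
      constructor
      · exact fun h p hp => (key p).1 (h _ (hmemD k p hp))
      · intro h z hz
        obtain ⟨p, hp, rfl⟩ := hDmem k z hz
        exact (key p).2 (h p hp)
    refine ⟨-A / B, (c - A * c₀) / B, (hbelow i).2 hfi, (habove j).2 hfj, ?_, ?_⟩
    · simpa only [hbelow] using hdown
    · simpa only [habove] using hup

/-- Contrapositive form of the main theorem: for `n ≥ 2` pairwise disjoint compact convex
plane sets, it is NOT the case that every pair admits a separating line with both open
halfplanes containing fewer than `⌈n/18⌉` of the sets. -/
theorem stmt_13 (n : ℕ) (hn : 2 ≤ n) (C : Fin n → Set (ℝ × ℝ))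
    (hne : ∀ i, (C i).Nonempty)
    (hcpt : ∀ i, IsCompact (C i)) (hconv : ∀ i, Convex ℝ (C i))
    (hdis : ∀ i j, i ≠ j → C i ∩ C j = ∅) :
    ¬ (∀ i j : Fin n, i ≠ j →
        ∃ (f : ℝ × ℝ →ₗ[ℝ] ℝ) (c : ℝ), f ≠ 0 ∧
          (∀ p ∈ C i, f p < c) ∧ (∀ p ∈ C j, c < f p) ∧
          ({k : Fin n | ∀ p ∈ C k, f p < c}.ncard < ⌈(n : ℝ) / 18⌉₊) ∧
          ({k : Fin n | ∀ p ∈ C k, c < f p}.ncard < ⌈(n : ℝ) / 18⌉₊)) := by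
  classical
  intro H
  obtain ⟨M, hMdef⟩ : ∃ M, M = ⌈(n : ℝ) / 18⌉₊ - 1 := ⟨_, rfl⟩
  have hceil : 0 < ⌈(n : ℝ) / 18⌉₊ := Nat.ceil_pos.2 (by positivity)
  have hMn : 18 * M < n := by
    have h1 : M < ⌈(n : ℝ) / 18⌉₊ := by omega
    rw [Nat.lt_ceil, lt_div_iff₀ (by norm_num)] at h1
    have h2 : ((18 * M : ℕ) : ℝ) < n := by push_cast; linarith
    exact_mod_cast h2
  obtain ⟨f₀, c₀, hf₀, h0, -, hL, hR⟩ :=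
    H ⟨0, by omega⟩ ⟨1, by omega⟩ (by simp [Fin.ext_iff])
  have hcard : ∀ P : Fin n → Prop, {k | P k}.ncard = (Finset.univ.filter P).card := by
    intro P
    rw [← Set.ncard_coe_finset]
    simp
  rw [hcard] at hL hR
  have hM : 0 < M := by
    have : 0 < (Finset.univ.filter fun k : Fin n => ∀ p ∈ C k, f₀ p < c₀).card :=
      Finset.card_pos.2 ⟨⟨0, by omega⟩, Finset.mem_filter.2 ⟨Finset.mem_univ _, h0⟩⟩
    omega
  set F := Finset.univ.filter fun k : Fin n =>
    ¬ (∀ p ∈ C k, f₀ p < c₀) ∧ ¬ (∀ p ∈ C k, c₀ < f₀ p) with hF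
  have hle := card_meeting_line_le F M hM C hne hcpt hconv hdis f₀ c₀ hf₀ ?_ ?_
  · have hcover : (Finset.univ : Finset (Fin n)) ⊆
        (Finset.univ.filter fun k => ∀ p ∈ C k, f₀ p < c₀) ∪
        (Finset.univ.filter fun k => ∀ p ∈ C k, c₀ < f₀ p) ∪ F := by
      intro k _
      simp only [hF, Finset.mem_union, Finset.mem_filter, Finset.mem_univ, true_and]
      tauto
    have h1 := (Finset.card_le_card hcover).trans (Finset.card_union_le _ _)
    have h2 := h1.trans (Nat.add_le_add_right (Finset.card_union_le _ _) _)
    rw [Finset.card_univ, Fintype.card_fin] at h2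
    omega
  · intro i hi
    obtain ⟨-, h1, h2⟩ := Finset.mem_filter.1 hi
    push Not at h1 h2
    exact exists_eq_of_convex (hconv i) f₀ h1 h2
  · intro i _ j _ hij
    obtain ⟨f, c, -, hfi, hfj, hdown, hup⟩ := H i j hij
    rw [hcard] at hdown hup
    refine ⟨f, c, hfi, hfj, ?_, ?_⟩
    · have := Finset.card_le_card (Finset.filter_subset_filter
        (fun k => ∀ p ∈ C k, f p < c) (Finset.subset_univ F))
      omega
    · have := Finset.card_le_card (Finset.filter_subset_filter
        (fun k => ∀ p ∈ C k, c < f p) (Finset.subset_univ F))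
      omega
end
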